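/- Let d ≥ 1 and s > 1/2, and let (f_n)_{n≥1} be a sequence of smooth functions ℝ^d → ℂ such that for every h > 0 one has sup_n ‖f_n‖_{𝒮_{s,h}} < ∞. Then there exists a subsequence (f_{n_k})_{k≥1} which is Cauchy with respect to the seminorm ‖·‖_{𝒮_{s,h}} for every h with 0 < h ≤ 1; that is, for every h ∈ (0,1] and every ε > 0 there exists K such that ‖f_{n_k} − f_{n_m}‖_{𝒮_{s,h}} < ε for all k, m ≥ K. -/

import Mathlib

open scoped Nat ENNReal
open MeasureTheory

/-- Partial derivative in the `j`-th coordinate direction. -/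
noncomputable def pd {n : ℕ} (j : Fin n) (f : EuclideanSpace ℝ (Fin n) → ℂ) :
    EuclideanSpace ℝ (Fin n) → ℂ :=
  fun z => fderiv ℝ f z (EuclideanSpace.single j 1)

/-- Iterated partial derivative `∂^α` for a multi-index `α ∈ ℕ^n`. -/
noncomputable def pdMulti {n : ℕ} (α : Fin n → ℕ) (f : EuclideanSpace ℝ (Fin n) → ℂ) :
    EuclideanSpace ℝ (Fin n) → ℂ :=
  (List.finRange n).foldr (fun j g => (pd j)^[α j] g) f

/-- The Gelfand–Shilov seminorm `‖f‖_{𝒮_{s,h}} = sup_{α,β,x} |x^α ∂^β f(x)| / (h^{|α+β|}(α!β!)^s)`,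
with value in `ℝ≥0∞` (so it is `∞` when the supremum is not finite). -/
noncomputable def gsSeminorm {d : ℕ} (s h : ℝ) (f : EuclideanSpace ℝ (Fin d) → ℂ) : ℝ≥0∞ :=
  ⨆ (α : Fin d → ℕ) (β : Fin d → ℕ) (x : EuclideanSpace ℝ (Fin d)),
    ENNReal.ofReal (‖(∏ j, (x j : ℂ) ^ (α j)) * pdMulti β f x‖ /
      (h ^ (∑ j, α j + ∑ j, β j) * ((∏ j, ((α j)! : ℝ)) * ∏ j, ((β j)! : ℝ)) ^ s))


section helpers

variable {n : ℕ}

lemma pd_smooth (j : Fin n) {f : EuclideanSpace ℝ (Fin n) → ℂ} (hf : ContDiff ℝ (⊤ : ℕ∞) f) :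
    ContDiff ℝ (⊤ : ℕ∞) (pd j f) := by
  have h : ContDiff ℝ (⊤ : ℕ∞) (fderiv ℝ f) := hf.fderiv_right (by simp)
  exact h.clm_apply contDiff_const

lemma pd_iter_smooth (j : Fin n) (k : ℕ) {f : EuclideanSpace ℝ (Fin n) → ℂ}
    (hf : ContDiff ℝ (⊤ : ℕ∞) f) : ContDiff ℝ (⊤ : ℕ∞) ((pd j)^[k] f) := by
  induction k with
  | zero => simpa using hf
  | succ k ih => rw [Function.iterate_succ_apply']; exact pd_smooth j ih

lemma foldr_smooth (l : List (Fin n)) (α : Fin n → ℕ) {f : EuclideanSpace ℝ (Fin n) → ℂ}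
    (hf : ContDiff ℝ (⊤ : ℕ∞) f) :
    ContDiff ℝ (⊤ : ℕ∞) (l.foldr (fun j g => (pd j)^[α j] g) f) := by
  induction l with
  | nil => simpa using hf
  | cons a l ih => exact pd_iter_smooth a _ ih

lemma pd_comm (i j : Fin n) {f : EuclideanSpace ℝ (Fin n) → ℂ} (hf : ContDiff ℝ (⊤ : ℕ∞) f) :
    pd i (pd j f) = pd j (pd i f) := by
  have h : ContDiff ℝ (⊤ : ℕ∞) (fderiv ℝ f) := hf.fderiv_right (by simp)
  have key : ∀ (i j : Fin n) z, pd i (pd j f) z =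
      fderiv ℝ (fderiv ℝ f) z (EuclideanSpace.single i 1) (EuclideanSpace.single j 1) := by
    intro i j z
    have hd : DifferentiableAt ℝ (fderiv ℝ f) z := (h.differentiable (by simp)) z
    have := (hd.hasFDerivAt.clm_apply
      (hasFDerivAt_const (EuclideanSpace.single j (1:ℝ)) z)).fderiv
    unfold pd
    rw [this]
    simp
  funext z
  rw [key, key]
  have hsym : IsSymmSndFDerivAt ℝ f z := by
    apply (hf.contDiffAt).isSymmSndFDerivAt
    simp only [minSmoothness_of_isRCLikeNormedField]
    exact WithTop.coe_le_coe.2 (le_top (a := (2 : ℕ∞)))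
  exact hsym _ _

lemma pd_iter_comm (i j : Fin n) (k : ℕ) {f : EuclideanSpace ℝ (Fin n) → ℂ}
    (hf : ContDiff ℝ (⊤ : ℕ∞) f) : (pd i)^[k] (pd j f) = pd j ((pd i)^[k] f) := by
  induction k with
  | zero => rfl
  | succ k ih =>
    rw [Function.iterate_succ_apply', Function.iterate_succ_apply', ih,
      pd_comm i j (pd_iter_smooth i k hf)]

lemma foldr_congr (l : List (Fin n)) (α β : Fin n → ℕ) (h : ∀ i ∈ l, α i = β i)
    (f : EuclideanSpace ℝ (Fin n) → ℂ) :
    l.foldr (fun j g => (pd j)^[α j] g) f = l.foldr (fun j g => (pd j)^[β j] g) f := by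
  induction l with
  | nil => rfl
  | cons a l ih =>
    simp only [List.foldr_cons]
    rw [ih (fun i hi => h i (List.mem_cons_of_mem _ hi)), h a List.mem_cons_self]

lemma foldr_succ (l : List (Fin n)) (hl : l.Nodup) (α : Fin n → ℕ) (j : Fin n) (hj : j ∈ l)
    {f : EuclideanSpace ℝ (Fin n) → ℂ} (hf : ContDiff ℝ (⊤ : ℕ∞) f) :
    l.foldr (fun i g => (pd i)^[(α + Pi.single j 1 : Fin n → ℕ) i] g) f =
      pd j (l.foldr (fun i g => (pd i)^[α i] g) f) := by
  induction l with
  | nil => simp at hj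
  | cons a l ih =>
    simp only [List.foldr_cons]
    rw [List.nodup_cons] at hl
    by_cases hja : j = a
    · subst hja
      rw [foldr_congr l (α + Pi.single j 1) α]
      · simp only [Pi.add_apply, Pi.single_eq_same]
        rw [Function.iterate_succ_apply']
      · intro i hi
        have : i ≠ j := fun h => hl.1 (h ▸ hi)
        simp [this]
    · have hj' : j ∈ l := by simpa [hja] using hj
      rw [ih hl.2 hj']
      have : (α + Pi.single j 1 : Fin n → ℕ) a = α a := by simp [Ne.symm hja]
      rw [this, pd_iter_comm _ _ _ (foldr_smooth l α hf)]

lemma pdMulti_smooth (α : Fin n → ℕ) {f : EuclideanSpace ℝ (Fin n) → ℂ}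
    (hf : ContDiff ℝ (⊤ : ℕ∞) f) : ContDiff ℝ (⊤ : ℕ∞) (pdMulti α f) := foldr_smooth _ α hf

lemma pdMulti_succ (α : Fin n → ℕ) (j : Fin n)
    {f : EuclideanSpace ℝ (Fin n) → ℂ} (hf : ContDiff ℝ (⊤ : ℕ∞) f) :
    pdMulti (α + Pi.single j 1) f = pd j (pdMulti α f) :=
  foldr_succ _ (List.nodup_finRange n) α j (List.mem_finRange j) hf

lemma pd_sub (j : Fin n) {f g : EuclideanSpace ℝ (Fin n) → ℂ}
    (hf : ContDiff ℝ (⊤ : ℕ∞) f) (hg : ContDiff ℝ (⊤ : ℕ∞) g) :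
    pd j (f - g) = pd j f - pd j g := by
  funext z
  simp only [pd, Pi.sub_apply]
  rw [fderiv_sub (hf.differentiable (by simp) z) (hg.differentiable (by simp) z)]
  rfl

lemma pd_iter_sub (j : Fin n) (k : ℕ) {f g : EuclideanSpace ℝ (Fin n) → ℂ}
    (hf : ContDiff ℝ (⊤ : ℕ∞) f) (hg : ContDiff ℝ (⊤ : ℕ∞) g) :
    (pd j)^[k] (f - g) = (pd j)^[k] f - (pd j)^[k] g := by
  induction k with
  | zero => rfl
  | succ k ih =>
    simp only [Function.iterate_succ_apply']
    rw [ih, pd_sub j (pd_iter_smooth j k hf) (pd_iter_smooth j k hg)]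

lemma pdMulti_sub (α : Fin n → ℕ) {f g : EuclideanSpace ℝ (Fin n) → ℂ}
    (hf : ContDiff ℝ (⊤ : ℕ∞) f) (hg : ContDiff ℝ (⊤ : ℕ∞) g) :
    pdMulti α (f - g) = pdMulti α f - pdMulti α g := by
  unfold pdMulti
  induction (List.finRange n) with
  | nil => rfl
  | cons a l ih =>
    simp only [List.foldr_cons]
    rw [ih, pd_iter_sub a _ (foldr_smooth l α hf) (foldr_smooth l α hg)]

lemma lip_of_pd {f : EuclideanSpace ℝ (Fin n) → ℂ} (hf : ContDiff ℝ (⊤ : ℕ∞) f)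
    (A : Fin n → ℝ) (hA : ∀ j z, ‖pd j f z‖ ≤ A j) (x y : EuclideanSpace ℝ (Fin n)) :
    ‖f x - f y‖ ≤ (∑ j, A j) * dist x y := by
  rw [dist_eq_norm]
  refine Convex.norm_image_sub_le_of_norm_fderiv_le (𝕜 := ℝ) (s := Set.univ)
    (fun z _ => hf.differentiable (by simp) z) ?_ convex_univ (Set.mem_univ y) (Set.mem_univ x)
  intro z _
  have hA0 : ∀ j, 0 ≤ A j := fun j => (norm_nonneg _).trans (hA j z)
  refine ContinuousLinearMap.opNorm_le_bound _ (Finset.sum_nonneg fun j _ => hA0 j) ?_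
  intro v
  have hv : v = ∑ j, v j • EuclideanSpace.single j (1:ℝ) := by
    have := (EuclideanSpace.basisFun (Fin n) ℝ).sum_repr v
    simpa using this.symm
  conv_lhs => rw [hv]
  rw [map_sum, Finset.sum_mul]
  refine (norm_sum_le _ _).trans (Finset.sum_le_sum fun j _ => ?_)
  rw [map_smul, norm_smul, mul_comm]
  exact mul_le_mul (hA j z) (PiLp.norm_apply_le v j) (norm_nonneg _) (hA0 j)

lemma unif_cauchy {E : Type*} [PseudoMetricSpace E] (D : Set E) (hD : Dense D) (B : Set E)
    (hB : IsCompact B) (F : ℕ → E → ℂ) (L : ℝ) 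
    (hL : ∀ n x y, ‖F n x - F n y‖ ≤ L * dist x y)
    (hc : ∀ q ∈ D, CauchySeq (fun n => F n q)) (ε : ℝ) (hε : 0 < ε) :
    ∃ K, ∀ k ≥ K, ∀ m ≥ K, ∀ x ∈ B, ‖F k x - F m x‖ ≤ ε := by
  set r : ℝ := ε / (3 * (|L| + 1)) with hr
  have hr0 : 0 < r := by positivity
  have hLr : |L| * r ≤ ε / 3 := by
    rw [hr, mul_div_assoc', div_le_div_iff₀ (by positivity) (by norm_num)]
    nlinarith [abs_nonneg L]
  obtain ⟨t, ht⟩ := hB.elim_finite_subcover (fun q : D => Metric.ball (q : E) r)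
    (fun q => Metric.isOpen_ball) (by
      intro x _
      obtain ⟨q, hq, hxq⟩ := hD.exists_dist_lt x hr0
      exact Set.mem_iUnion.2 ⟨⟨q, hq⟩, hxq⟩)
  have h1 : ∀ q : D, ∃ K, ∀ k ≥ K, ∀ m ≥ K, dist (F k q) (F m q) < ε / 3 := fun q =>
    Metric.cauchySeq_iff.1 (hc q q.2) _ (by positivity)
  choose K hK using h1
  refine ⟨t.sup K, fun k hk m hm x hx => ?_⟩
  obtain ⟨q, hqt, hxq⟩ := Set.mem_iUnion₂.1 (ht hx)
  have hq : t.sup K ≥ K q := Finset.le_sup hqt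
  have h2 := hK q k (hq.trans hk) m (hq.trans hm)
  rw [dist_eq_norm] at h2
  have hxq' : dist x q ≤ r := le_of_lt hxq
  have h3 : ∀ n, ‖F n x - F n q‖ ≤ ε / 3 := fun n => by
    refine (hL n x q).trans (le_trans ?_ hLr)
    exact mul_le_mul (le_abs_self L) hxq' dist_nonneg (abs_nonneg L)
  have h4 := h3 k
  have h5 := h3 m
  calc ‖F k x - F m x‖ = ‖(F k x - F k q) + (F k q - F m q) - (F m x - F m q)‖ := by
        congr 1; ring
    _ ≤ ‖F k x - F k q‖ + ‖F k q - F m q‖ + ‖F m x - F m q‖ :=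
        (norm_sub_le _ _).trans (by gcongr; exact norm_add_le _ _)
    _ ≤ ε := by linarith

lemma diag_subseq {ι : Type*} [Countable ι] (u : ℕ → ι → ℂ) (A : ι → ℝ)
    (hA : ∀ n i, ‖u n i‖ ≤ A i) :
    ∃ σ : ℕ → ℕ, StrictMono σ ∧ ∀ i, CauchySeq (fun k => u (σ k) i) := by
  have hc : IsCompact (Set.pi Set.univ (fun i => Metric.closedBall (0:ℂ) (A i))) :=
    isCompact_univ_pi fun i => isCompact_closedBall _ _
  obtain ⟨a, _, σ, hσ, ht⟩ := hc.tendsto_subseq (x := u) (fun n i _ => by simpa using hA n i)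
  refine ⟨σ, hσ, fun i => ?_⟩
  exact ((tendsto_pi_nhds.1 ht) i).cauchySeq

end helpers

lemma gs_bound {d : ℕ} (s : ℝ) (f : ℕ → EuclideanSpace ℝ (Fin d) → ℂ)
    (hbdd : ∀ h : ℝ, 0 < h → (⨆ n, gsSeminorm s h (f n)) < ⊤) (h : ℝ) (hh : 0 < h) :
    ∃ C : ℝ, 0 ≤ C ∧ ∀ n (α β : Fin d → ℕ) (x : EuclideanSpace ℝ (Fin d)),
      ‖(∏ j, (x j : ℂ) ^ (α j)) * pdMulti β (f n) x‖ ≤ C *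
      (h ^ (∑ j, α j + ∑ j, β j) * ((∏ j, ((α j)! : ℝ)) * ∏ j, ((β j)! : ℝ)) ^ s) := by
  refine ⟨_, ENNReal.toReal_nonneg (a := ⨆ n, gsSeminorm s h (f n)), fun n α β x => ?_⟩
  have hpos : 0 < h ^ (∑ j, α j + ∑ j, β j) *
      ((∏ j, ((α j)! : ℝ)) * ∏ j, ((β j)! : ℝ)) ^ s := by positivity
  rw [← div_le_iff₀ hpos, ← ENNReal.ofReal_le_iff_le_toReal (hbdd h hh).ne]
  refine le_trans ?_ (le_iSup (fun n => gsSeminorm s h (f n)) n)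
  unfold gsSeminorm
  exact le_iSup_of_le α (le_iSup_of_le β (le_iSup_of_le x le_rfl))

lemma fixed_pair {d : ℕ} (f : ℕ → EuclideanSpace ℝ (Fin d) → ℂ)
    (hsm : ∀ n, ContDiff ℝ (⊤ : ℕ∞) (f n))
    (A : (Fin d → ℕ) → (Fin d → ℕ) → ℝ)
    (hA : ∀ n α β x, ‖(∏ j, (x j : ℂ) ^ (α j)) * pdMulti β (f n) x‖ ≤ A α β)
    (D : Set (EuclideanSpace ℝ (Fin d))) (hD : Dense D)
    (hc : ∀ q ∈ D, ∀ β, CauchySeq (fun n => pdMulti β (f n) q))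
    (α β : Fin d → ℕ) (ε : ℝ) (hε : 0 < ε) :
    ∃ K, ∀ k ≥ K, ∀ m ≥ K, ∀ x,
      ‖(∏ j, (x j : ℂ) ^ (α j)) * pdMulti β (f k - f m) x‖ ≤ ε := by
  have hA0 : ∀ α β, 0 ≤ A α β := fun α β => (norm_nonneg _).trans (hA 0 α β 0)
  set M : ℝ := ∑ j, A (α + Pi.single j 1) β with hM
  have hM0 : 0 ≤ M := Finset.sum_nonneg fun j _ => hA0 _ _
  set R : ℝ := 1 + 2 * M / ε with hR
  have hR1 : 1 ≤ R := by rw [hR]; have : 0 ≤ 2 * M / ε := by positivity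
                         linarith
  have hMR : 2 * M ≤ ε * R := by
    rw [hR, mul_add, mul_div_cancel₀ _ hε.ne']; linarith
  have hRp : 0 < R ^ (∑ j, α j) := by positivity
  obtain ⟨K, hK⟩ := unif_cauchy D hD (Metric.closedBall 0 (Real.sqrt (d * R ^ 2)))
    (isCompact_closedBall _ _) (fun n => pdMulti β (f n)) (∑ j, A 0 (β + Pi.single j 1))
    (fun n x y => lip_of_pd (pdMulti_smooth β (hsm n)) (fun j => A 0 (β + Pi.single j 1))
      (fun j z => by
        rw [← pdMulti_succ β j (hsm n)]
        simpa using hA n 0 (β + Pi.single j 1) z) x y)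
    (fun q hq => hc q hq β) (ε / R ^ (∑ j, α j)) (by positivity)
  refine ⟨K, fun k hk m hm x => ?_⟩
  rw [pdMulti_sub β (hsm k) (hsm m), Pi.sub_apply]
  by_cases hx : ∃ j, R ≤ |x j|
  · obtain ⟨j, hj⟩ := hx
    have h1 : ∀ n, |x j| * ‖(∏ i, (x i : ℂ) ^ (α i)) * pdMulti β (f n) x‖ ≤ M := by
      intro n
      refine le_trans (le_of_eq ?_) ((hA n (α + Pi.single j 1) β x).trans
        (Finset.single_le_sum (f := fun j => A (α + Pi.single j 1) β)
          (fun i _ => hA0 _ _) (Finset.mem_univ j)))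
      have : ∏ i, (x i : ℂ) ^ ((α + Pi.single j 1 : Fin d → ℕ) i) = (x j : ℂ) * ∏ i, (x i : ℂ) ^ (α i) := by
        simp only [Pi.add_apply, pow_add, Finset.prod_mul_distrib]
        rw [mul_comm]
        congr 1
        rw [Finset.prod_eq_single j]
        · simp
        · intro b _ hb; simp [hb]
        · simp
      rw [this, mul_assoc, norm_mul (x j : ℂ), Complex.norm_real, Real.norm_eq_abs]
    have h2 : |x j| * ‖(∏ i, (x i : ℂ) ^ (α i)) * (pdMulti β (f k) x - pdMulti β (f m) x)‖
        ≤ 2 * M := by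
      rw [mul_sub]
      calc _ ≤ |x j| * (‖(∏ i, (x i : ℂ) ^ (α i)) * pdMulti β (f k) x‖ +
            ‖(∏ i, (x i : ℂ) ^ (α i)) * pdMulti β (f m) x‖) := by
              gcongr; exact norm_sub_le _ _
        _ ≤ _ := by rw [mul_add]; linarith [h1 k, h1 m]
    have h3 : R * ‖(∏ i, (x i : ℂ) ^ (α i)) * (pdMulti β (f k) x - pdMulti β (f m) x)‖
        ≤ R * ε := by
      refine le_trans ?_ (h2.trans (hMR.trans (mul_comm _ _).le))
      gcongr
    exact le_of_mul_le_mul_left h3 (by linarith)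
  · push Not at hx
    have hxB : x ∈ Metric.closedBall (0 : EuclideanSpace ℝ (Fin d)) (Real.sqrt (d * R ^ 2)) := by
      rw [mem_closedBall_zero_iff, EuclideanSpace.norm_eq]
      apply Real.sqrt_le_sqrt
      calc ∑ i, ‖x i‖ ^ 2 ≤ ∑ _i : Fin d, R ^ 2 := Finset.sum_le_sum fun i _ => by
            gcongr; exact (hx i).le
        _ = _ := by simp
    have h1 := hK k hk m hm x hxB
    rw [norm_mul, norm_prod]
    have h2 : ∏ i, ‖(x i : ℂ) ^ (α i)‖ ≤ R ^ (∑ j, α j) := by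
      rw [← Finset.prod_pow_eq_pow_sum]
      refine Finset.prod_le_prod (fun i _ => norm_nonneg _) fun i _ => ?_
      rw [norm_pow, Complex.norm_real, Real.norm_eq_abs]
      gcongr; exact (hx i).le
    calc _ ≤ R ^ (∑ j, α j) * (ε / R ^ (∑ j, α j)) := by gcongr
      _ = ε := mul_div_cancel₀ _ hRp.ne'

/-- Let `d ≥ 1`, `s > 1/2` and let `(f_n)` be a sequence of smooth functions
on `ℝ^d` with `sup_n ‖f_n‖_{𝒮_{s,h}} < ∞` for every `h > 0`.  Then there is a subsequence
`(f_{n_k})` which is Cauchy with respect to the seminorm `‖·‖_{𝒮_{s,h}}` for every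
`0 < h ≤ 1`. -/
theorem gs_bounded_seq_has_cauchy_subseq (d : ℕ) (hd : 1 ≤ d) (s : ℝ) (hs : 1 / 2 < s)
    (f : ℕ → EuclideanSpace ℝ (Fin d) → ℂ) (hsm : ∀ n, ContDiff ℝ (⊤ : ℕ∞) (f n))
    (hbdd : ∀ h : ℝ, 0 < h → (⨆ n, gsSeminorm s h (f n)) < ⊤) :
    ∃ σ : ℕ → ℕ, StrictMono σ ∧
      ∀ h : ℝ, 0 < h → h ≤ 1 → ∀ ε : ℝ, 0 < ε → ∃ K : ℕ,
        ∀ k ≥ K, ∀ m ≥ K,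
          gsSeminorm s h (f (σ k) - f (σ m)) < ENNReal.ofReal ε := by
  -- bounds
  choose C hC0 hC using gs_bound s f hbdd
  set A : (Fin d → ℕ) → (Fin d → ℕ) → ℝ := fun α β => C 1 one_pos *
      ((1:ℝ) ^ (∑ j, α j + ∑ j, β j) * ((∏ j, ((α j)! : ℝ)) * ∏ j, ((β j)! : ℝ)) ^ s) with hAdef
  have hA : ∀ n α β x, ‖(∏ j, (x j : ℂ) ^ (α j)) * pdMulti β (f n) x‖ ≤ A α β :=
    fun n α β x => hC 1 one_pos n α β x
  let e := TopologicalSpace.denseSeq (EuclideanSpace ℝ (Fin d))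
  obtain ⟨σ, hσ, hcau⟩ := diag_subseq (ι := ℕ × (Fin d → ℕ))
    (fun n p => pdMulti p.2 (f n) (e p.1)) (fun p => A 0 p.2)
    (fun n p => by simpa using hA n 0 p.2 (e p.1))
  refine ⟨σ, hσ, fun h hh _ ε hε => ?_⟩
  have hh2 : 0 < h / 2 := by positivity
  set c := C (h / 2) hh2 with hc
  have hc0 : 0 ≤ c := hC0 _ _
  obtain ⟨N, hN⟩ : ∃ N : ℕ, 2 * c * (1 / 2 : ℝ) ^ N < ε / 2 := by
    obtain ⟨N, hN⟩ := exists_pow_lt_of_lt_one (y := (1 / 2 : ℝ))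
      (show 0 < ε / 2 / (2 * c + 1) by positivity) (by norm_num)
    refine ⟨N, ?_⟩
    rw [lt_div_iff₀ (by positivity)] at hN
    have : 0 < (1 / 2 : ℝ) ^ N := by positivity
    nlinarith
  have hW : ∀ α β : Fin d → ℕ, 0 < h ^ (∑ j, α j + ∑ j, β j) *
      ((∏ j, ((α j)! : ℝ)) * ∏ j, ((β j)! : ℝ)) ^ s := fun α β => by positivity
  have hfix : ∀ α β : Fin d → ℕ, ∃ K, ∀ k ≥ K, ∀ m ≥ K, ∀ x : EuclideanSpace ℝ (Fin d),
      ‖(∏ j, (x j : ℂ) ^ (α j)) * pdMulti β (f (σ k) - f (σ m)) x‖ ≤ ε / 2 *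
      (h ^ (∑ j, α j + ∑ j, β j) *
      ((∏ j, ((α j)! : ℝ)) * ∏ j, ((β j)! : ℝ)) ^ s) := fun α β =>
    fixed_pair (fun n => f (σ n)) (fun n => hsm _) A (fun n => hA _) (Set.range e)
      (TopologicalSpace.denseRange_denseSeq _)
      (by rintro _ ⟨i, rfl⟩ β; exact hcau (i, β)) α β _ (mul_pos (by positivity) (hW α β))
  choose K hK using hfix
  let T : Finset (Fin d → ℕ) := Finset.Iic (fun _ => N)
  have hT : ∀ α : Fin d → ℕ, ∑ j, α j ≤ N → α ∈ T := fun α hα => by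
    rw [Finset.mem_Iic]
    intro j
    exact (Finset.single_le_sum (f := α) (fun _ _ => Nat.zero_le _) (Finset.mem_univ j)).trans hα
  refine ⟨(T ×ˢ T).sup (fun p => K p.1 p.2), fun k hk m hm => ?_⟩
  refine lt_of_le_of_lt ?_ ((ENNReal.ofReal_lt_ofReal_iff hε).2 (half_lt_self hε))
  unfold gsSeminorm
  refine iSup_le fun α => iSup_le fun β => iSup_le fun x => ?_
  apply ENNReal.ofReal_le_ofReal
  rw [div_le_iff₀ (hW α β)]
  by_cases hab : ∑ j, α j + ∑ j, β j ≤ N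
  · have hmem : (α, β) ∈ T ×ˢ T :=
      Finset.mem_product.2 ⟨hT α (by omega), hT β (by omega)⟩
    have hle : K α β ≤ (T ×ˢ T).sup (fun p => K p.1 p.2) :=
      Finset.le_sup (f := fun p : (Fin d → ℕ) × (Fin d → ℕ) => K p.1 p.2) hmem
    exact hK α β k (hle.trans hk) m (hle.trans hm) x
  · rw [pdMulti_sub β (hsm _) (hsm _), Pi.sub_apply, mul_sub]
    refine (norm_sub_le _ _).trans ((add_le_add (hC _ hh2 (σ k) α β x)
      (hC _ hh2 (σ m) α β x)).trans ?_)
    rw [← hc]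
    have hp : (h / 2) ^ (∑ j, α j + ∑ j, β j) =
        (1 / 2 : ℝ) ^ (∑ j, α j + ∑ j, β j) * h ^ (∑ j, α j + ∑ j, β j) := by
      rw [← mul_pow]; congr 1; ring
    have hle : (1 / 2 : ℝ) ^ (∑ j, α j + ∑ j, β j) ≤ (1 / 2 : ℝ) ^ N :=
      pow_le_pow_of_le_one (by norm_num) (by norm_num) (by omega)
    have h2 : 2 * c * (1 / 2 : ℝ) ^ (∑ j, α j + ∑ j, β j) ≤ ε / 2 :=
      (mul_le_mul_of_nonneg_left hle (by positivity)).trans hN.le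
    rw [hp]
    refine le_trans (le_of_eq ?_) (mul_le_mul_of_nonneg_right h2 (hW α β).le)
    ring
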